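/- Let M be the real symplectic matrix given as the direct ◇-sum M = N₁(1,1)^{◇p₋} ◇ I_{2p₀} ◇ N₁(1,−1)^{◇p₊} ◇ N₁(−1,1)^{◇q₋} ◇ (−I_{2q₀}) ◇ N₁(−1,−1)^{◇q₊} ◇ N₂(e^{iα₁},A₁) ◇ ⋯ ◇ N₂(e^{iα_{r*}},A_{r*}) ◇ N₂(e^{iβ₁},B₁) ◇ ⋯ ◇ N₂(e^{iβ_{r₀}},B_{r₀}) ◇ R(θ₁) ◇ ⋯ ◇ R(θ_r) ◇ D(2)^{◇h}, where p₋, p₀, p₊, q₋, q₀, q₊, r, r*, r₀, h are non-negative integers, each angle θ_j, α_j, β_j lies in (0,π) ∪ (π,2π), and each 2×2 block A_j, B_j = [[b₁,b₂],[b₃,b₄]] satisfies b₂ ≠ b₃. Then for every positive integer m: dim_ℝ ker(M^m − I) = (p₋ + 2p₀ + p₊) + ((1+(−1)^m)/2)·(q₋ + 2q₀ + q₊) + 2·ς(m), where ς(m) = #{1 ≤ j ≤ r : mθ_j/2π ∈ ℤ} + #{1 ≤ j ≤ r* : mα_j/2π ∈ ℤ} + #{1 ≤ j ≤ r₀ :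 mβ_j/2π ∈ ℤ}. In particular dim ker(M − I) = p₋ + 2p₀ + p₊. -/

import Mathlib

open Matrix

noncomputable section

/-- The `2 × 2` rotation matrix `R(θ)`. -/
def rot2 (θ : ℝ) : Matrix (Fin 2) (Fin 2) ℝ :=
  !![Real.cos θ, -Real.sin θ; Real.sin θ, Real.cos θ]

/-- The rotation matrix `R(θ)` written in half-split `(1+1) × (1+1)` block form. -/
def rotBlock (θ : ℝ) : Matrix (Fin 1 ⊕ Fin 1) (Fin 1 ⊕ Fin 1) ℝ :=
  fromBlocks (Real.cos θ • 1) ((-Real.sin θ) • 1) (Real.sin θ • 1) (Real.cos θ • 1)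

/-- The basic normal form `N₁(λ, b) = [[λ, b], [0, λ]]` in half-split form. -/
def N1Block (l b : ℝ) : Matrix (Fin 1 ⊕ Fin 1) (Fin 1 ⊕ Fin 1) ℝ :=
  fromBlocks (l • 1) (b • 1) 0 (l • 1)

/-- The basic normal form `N₂(e^{iθ}, B) = [[R(θ), B], [0, R(θ)]]` in half-split form. -/
def N2Block (θ : ℝ) (B : Matrix (Fin 2) (Fin 2) ℝ) :
    Matrix (Fin 2 ⊕ Fin 2) (Fin 2 ⊕ Fin 2) ℝ :=
  fromBlocks (rot2 θ) B 0 (rot2 θ)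

/-- The basic normal form `D(λ) = diag(λ, λ⁻¹)` in half-split form. -/
def DBlock (l : ℝ) : Matrix (Fin 1 ⊕ Fin 1) (Fin 1 ⊕ Fin 1) ℝ :=
  fromBlocks (l • 1) 0 0 (l⁻¹ • 1)

/-- The `◇`-sum of a family of matrices, each written in half-split block form
`[[Aₜ, Bₜ], [Cₜ, Dₜ]]` over `d t ⊕ d t`: the result is
`[[⊕ₜAₜ, ⊕ₜBₜ], [⊕ₜCₜ, ⊕ₜDₜ]]`, i.e. the four quarter-blocks are the
block-diagonal sums of the corresponding quarter-blocks of the summands. -/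
def diamondSum {ι : Type} [DecidableEq ι] {d : ι → Type}
    (Mfam : ∀ t, Matrix (d t ⊕ d t) (d t ⊕ d t) ℝ) :
    Matrix ((Σ t, d t) ⊕ (Σ t, d t)) ((Σ t, d t) ⊕ (Σ t, d t)) ℝ :=
  fromBlocks
    (blockDiagonal' fun t => Matrix.of fun x y => Mfam t (Sum.inl x) (Sum.inl y))
    (blockDiagonal' fun t => Matrix.of fun x y => Mfam t (Sum.inl x) (Sum.inr y))
    (blockDiagonal' fun t => Matrix.of fun x y => Mfam t (Sum.inr x) (Sum.inl y))
    (blockDiagonal' fun t => Matrix.of fun x y => Mfam t (Sum.inr x) (Sum.inr y))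

/-- Index type for the normal form
`N₁(1,1)^{◇p₋} ◇ I_{2p₀} ◇ N₁(1,-1)^{◇p₊} ◇ N₁(-1,1)^{◇q₋} ◇ (-I_{2q₀}) ◇
N₁(-1,-1)^{◇q₊} ◇ N₂(e^{iα₁},A₁) ◇ ⋯ ◇ N₂(e^{iα_{r*}},A_{r*}) ◇
N₂(e^{iβ₁},B₁) ◇ ⋯ ◇ N₂(e^{iβ_{r₀}},B_{r₀}) ◇ R(θ₁) ◇ ⋯ ◇ R(θ_r) ◇ D(2)^{◇h}`. -/
abbrev NFIdx (pm p0 pp qm q0 qp rs r0 r hc : ℕ) : Type :=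
  (Fin pm ⊕ Fin p0 ⊕ Fin pp) ⊕ (Fin qm ⊕ Fin q0 ⊕ Fin qp) ⊕
    (Fin rs ⊕ Fin r0) ⊕ (Fin r ⊕ Fin hc)

/-- Half-size of each elementary block: `1` for the `2 × 2` blocks and `2` for
the `4 × 4` blocks `N₂`. -/
def NFSize (pm p0 pp qm q0 qp rs r0 r hc : ℕ) :
    NFIdx pm p0 pp qm q0 qp rs r0 r hc → Type
  | .inl _ => Fin 1
  | .inr (.inl _) => Fin 1
  | .inr (.inr (.inl _)) => Fin 2
  | .inr (.inr (.inr _)) => Fin 1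

instance NFSize.instFintype (pm p0 pp qm q0 qp rs r0 r hc : ℕ) :
    ∀ t, Fintype (NFSize pm p0 pp qm q0 qp rs r0 r hc t)
  | .inl _ => inferInstanceAs (Fintype (Fin 1))
  | .inr (.inl _) => inferInstanceAs (Fintype (Fin 1))
  | .inr (.inr (.inl _)) => inferInstanceAs (Fintype (Fin 2))
  | .inr (.inr (.inr _)) => inferInstanceAs (Fintype (Fin 1))

instance NFSize.instDecidableEq (pm p0 pp qm q0 qp rs r0 r hc : ℕ) :
    ∀ t, DecidableEq (NFSize pm p0 pp qm q0 qp rs r0 r hc t)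
  | .inl _ => inferInstanceAs (DecidableEq (Fin 1))
  | .inr (.inl _) => inferInstanceAs (DecidableEq (Fin 1))
  | .inr (.inr (.inl _)) => inferInstanceAs (DecidableEq (Fin 2))
  | .inr (.inr (.inr _)) => inferInstanceAs (DecidableEq (Fin 1))

instance NFTotal.instDecidableEq (pm p0 pp qm q0 qp rs r0 r hc : ℕ) :
    DecidableEq ((t : NFIdx pm p0 pp qm q0 qp rs r0 r hc) ×
      NFSize pm p0 pp qm q0 qp rs r0 r hc t) :=
  Sigma.instDecidableEqSigma

/-- The family of elementary blocks of the normal form. -/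
def NFBlocks (pm p0 pp qm q0 qp rs r0 r hc : ℕ)
    (α : Fin rs → ℝ) (A : Fin rs → Matrix (Fin 2) (Fin 2) ℝ)
    (β : Fin r0 → ℝ) (B : Fin r0 → Matrix (Fin 2) (Fin 2) ℝ)
    (θ : Fin r → ℝ) :
    ∀ t : NFIdx pm p0 pp qm q0 qp rs r0 r hc,
      Matrix (NFSize pm p0 pp qm q0 qp rs r0 r hc t ⊕
              NFSize pm p0 pp qm q0 qp rs r0 r hc t)
             (NFSize pm p0 pp qm q0 qp rs r0 r hc t ⊕
              NFSize pm p0 pp qm q0 qp rs r0 r hc t) ℝ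
  | .inl (.inl _) => N1Block 1 1
  | .inl (.inr (.inl _)) => 1
  | .inl (.inr (.inr _)) => N1Block 1 (-1)
  | .inr (.inl (.inl _)) => N1Block (-1) 1
  | .inr (.inl (.inr (.inl _))) => -1
  | .inr (.inl (.inr (.inr _))) => N1Block (-1) (-1)
  | .inr (.inr (.inl (.inl j))) => N2Block (α j) (A j)
  | .inr (.inr (.inl (.inr j))) => N2Block (β j) (B j)
  | .inr (.inr (.inr (.inl j))) => rotBlock (θ j)
  | .inr (.inr (.inr (.inr _))) => DBlock 2

/-- The normal form matrix
`M = N₁(1,1)^{◇p₋} ◇ I_{2p₀} ◇ N₁(1,-1)^{◇p₊} ◇ N₁(-1,1)^{◇q₋} ◇ (-I_{2q₀}) ◇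
N₁(-1,-1)^{◇q₊} ◇ N₂(e^{iα₁},A₁) ◇ ⋯ ◇ N₂(e^{iα_{r*}},A_{r*}) ◇
N₂(e^{iβ₁},B₁) ◇ ⋯ ◇ N₂(e^{iβ_{r₀}},B_{r₀}) ◇ R(θ₁) ◇ ⋯ ◇ R(θ_r) ◇ D(2)^{◇h}`. -/
def NFMatrix (pm p0 pp qm q0 qp rs r0 r hc : ℕ)
    (α : Fin rs → ℝ) (A : Fin rs → Matrix (Fin 2) (Fin 2) ℝ)
    (β : Fin r0 → ℝ) (B : Fin r0 → Matrix (Fin 2) (Fin 2) ℝ)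
    (θ : Fin r → ℝ) :=
  diamondSum (NFBlocks pm p0 pp qm q0 qp rs r0 r hc α A β B θ)

/-- The nullity of a square real matrix. -/
def matNullity {n : Type} [Fintype n] [DecidableEq n] (M : Matrix n n ℝ) : ℕ :=
  Module.finrank ℝ (LinearMap.ker (Matrix.toLin' M))

section Nullity

variable {n : Type} [Fintype n] [DecidableEq n]

theorem matNullity_add_rank (M : Matrix n n ℝ) : matNullity M + M.rank = Fintype.card n := by
  have h := LinearMap.finrank_range_add_finrank_ker (Matrix.toLin' M)
  rw [Module.finrank_fintype_fun_eq_card] at h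
  rw [matNullity, Matrix.rank, ← Matrix.toLin'_apply', add_comm]
  exact h

theorem matNullity_zero : matNullity (0 : Matrix n n ℝ) = Fintype.card n := by
  simpa using matNullity_add_rank (0 : Matrix n n ℝ)

theorem matNullity_eq_zero {M : Matrix n n ℝ} (h : M.det ≠ 0) : matNullity M = 0 := by
  have h1 := matNullity_add_rank M
  rw [Matrix.rank_of_isUnit M ((Matrix.isUnit_iff_isUnit_det M).2 h.isUnit)] at h1
  omega

theorem matNullity_submatrix {m : Type} [Fintype m] [DecidableEq m] (M : Matrix n n ℝ)
    (e : m ≃ n) : matNullity (M.submatrix e e) = matNullity M := by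
  have h1 := matNullity_add_rank M
  have h2 := matNullity_add_rank (M.submatrix e e)
  rw [Matrix.rank_submatrix, Fintype.card_congr e] at h2
  omega

theorem matNullity_fromBlocks_zero {C : Matrix n n ℝ} (h : C.det ≠ 0) :
    matNullity (fromBlocks 0 C 0 (0 : Matrix n n ℝ)) = Fintype.card n := by
  have hC : ∀ v : n → ℝ, C *ᵥ v = 0 ↔ v = 0 := fun v =>
    ⟨Matrix.eq_zero_of_mulVec_eq_zero h, fun hv => by rw [hv, Matrix.mulVec_zero]⟩
  let e : (n → ℝ) →ₗ[ℝ] (n ⊕ n → ℝ) :=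
    { toFun := fun v => Sum.elim v 0
      map_add' := fun v w => by ext (i | i) <;> simp
      map_smul' := fun c v => by ext (i | i) <;> simp }
  have he : Function.Injective e := fun v w hvw => by
    ext i
    exact congrFun hvw (Sum.inl i)
  have hk : LinearMap.ker (Matrix.toLin' (fromBlocks 0 C 0 (0 : Matrix n n ℝ))) =
        LinearMap.range e := by
    ext w
    rw [LinearMap.mem_ker, Matrix.toLin'_apply, Matrix.fromBlocks_mulVec, LinearMap.mem_range]
    constructor
    · intro hw
      have h0 : C *ᵥ (w ∘ Sum.inr) = 0 := by
        ext i
        simpa using congrFun hw (Sum.inl i)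
      rw [hC] at h0
      refine ⟨w ∘ Sum.inl, ?_⟩
      ext (i | i)
      · rfl
      · exact (congrFun h0 i).symm
    · rintro ⟨v, rfl⟩
      have h0 : e v ∘ Sum.inr = 0 := rfl
      rw [h0]
      ext (i | i) <;> simp
  rw [matNullity, hk, LinearMap.finrank_range_of_inj he, Module.finrank_fintype_fun_eq_card]

end Nullity

section DiamondSum

variable {ι : Type} [DecidableEq ι] {d : ι → Type}

theorem diamondSum_eq_submatrix (M : ∀ t, Matrix (d t ⊕ d t) (d t ⊕ d t) ℝ) :
    diamondSum M = (blockDiagonal' M).submatrix (Equiv.sigmaSumDistrib d d).symm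
      (Equiv.sigmaSumDistrib d d).symm := by
  have hl : ∀ t x, (Equiv.sigmaSumDistrib d d).symm (Sum.inl ⟨t, x⟩) = ⟨t, Sum.inl x⟩ :=
    fun _ _ => rfl
  have hr : ∀ t x, (Equiv.sigmaSumDistrib d d).symm (Sum.inr ⟨t, x⟩) = ⟨t, Sum.inr x⟩ :=
    fun _ _ => rfl
  ext (⟨s, x⟩ | ⟨s, x⟩) (⟨t, y⟩ | ⟨t, y⟩) <;>
  · by_cases h : s = t
    · subst h
      simp only [diamondSum, Matrix.submatrix_apply, hl, hr, Matrix.fromBlocks_apply₁₁,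
        Matrix.fromBlocks_apply₁₂, Matrix.fromBlocks_apply₂₁, Matrix.fromBlocks_apply₂₂,
        Matrix.blockDiagonal'_apply_eq, Matrix.of_apply]
    · simp only [diamondSum, Matrix.submatrix_apply, hl, hr, Matrix.fromBlocks_apply₁₁,
        Matrix.fromBlocks_apply₁₂, Matrix.fromBlocks_apply₂₁, Matrix.fromBlocks_apply₂₂,
        Matrix.blockDiagonal'_apply_ne _ _ _ h]

variable [Fintype ι] [∀ t, Fintype (d t)]

theorem blockDiagonal'_mulVec_apply (N : ∀ t, Matrix (d t) (d t) ℝ) (v : (Σ t, d t) → ℝ)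
    (t : ι) (x : d t) :
    (blockDiagonal' N *ᵥ v) ⟨t, x⟩ = (N t *ᵥ fun y => v ⟨t, y⟩) x := by
  simp only [Matrix.mulVec, dotProduct]
  rw [Fintype.sum_sigma, Finset.sum_eq_single t]
  · simp [Matrix.blockDiagonal'_apply_eq]
  · intro s _ hs
    exact Finset.sum_eq_zero fun y _ => by
      rw [Matrix.blockDiagonal'_apply_ne _ _ _ hs.symm, zero_mul]
  · simp

variable [∀ t, DecidableEq (d t)]

theorem matNullity_blockDiagonal' (N : ∀ t, Matrix (d t) (d t) ℝ) :
    matNullity (blockDiagonal' N) = ∑ t, matNullity (N t) := by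
  let e : LinearMap.ker (Matrix.toLin' (blockDiagonal' N)) ≃ₗ[ℝ]
      (∀ t, LinearMap.ker (Matrix.toLin' (N t))) :=
    { toFun := fun v t => ⟨fun x => v.1 ⟨t, x⟩, by
        rw [LinearMap.mem_ker, Matrix.toLin'_apply]
        ext x
        rw [← blockDiagonal'_mulVec_apply N v.1 t x]
        exact congrFun (LinearMap.mem_ker.1 v.2) ⟨t, x⟩⟩
      map_add' := fun v w => rfl
      map_smul' := fun c v => rfl
      invFun := fun w => ⟨fun p => (w p.1).1 p.2, by
        rw [LinearMap.mem_ker, Matrix.toLin'_apply]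
        ext ⟨t, x⟩
        rw [blockDiagonal'_mulVec_apply]
        exact congrFun (LinearMap.mem_ker.1 (w t).2) x⟩
      left_inv := fun v => rfl
      right_inv := fun w => rfl }
  rw [matNullity, e.finrank_eq, Module.finrank_pi_fintype]
  rfl

theorem matNullity_diamondSum_pow_sub_one (M : ∀ t, Matrix (d t ⊕ d t) (d t ⊕ d t) ℝ) (m : ℕ) :
    matNullity (diamondSum M ^ m - 1) = ∑ t, matNullity (M t ^ m - 1) := by
  have h : diamondSum M ^ m - 1 =
      (blockDiagonal' fun t => M t ^ m - 1).submatrix (Equiv.sigmaSumDistrib d d).symm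
        (Equiv.sigmaSumDistrib d d).symm := by
    have h1 : (blockDiagonal' fun t => M t ^ m - 1) = blockDiagonal' M ^ m - 1 := by
      rw [← Matrix.blockDiagonal'_pow, ← Matrix.blockDiagonal'_one, ← Matrix.blockDiagonal'_sub]
      rfl
    have h2 : ∀ k : ℕ, diamondSum M ^ k =
        (blockDiagonal' M ^ k).submatrix (Equiv.sigmaSumDistrib d d).symm
          (Equiv.sigmaSumDistrib d d).symm := by
      intro k
      induction k with
      | zero => simp
      | succ k ih =>
        rw [pow_succ, pow_succ, ih, diamondSum_eq_submatrix, Matrix.submatrix_mul_equiv]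
    rw [h1, h2, Matrix.submatrix_sub, Pi.sub_apply, Pi.sub_apply, Matrix.submatrix_one_equiv]
  rw [h, matNullity_submatrix, matNullity_blockDiagonal']

end DiamondSum

section Blocks

theorem fromBlocks_sub_one {n : Type} [DecidableEq n] (A B C D : Matrix n n ℝ) :
    fromBlocks A B C D - 1 = fromBlocks (A - 1) B C (D - 1) := by
  ext (i | i) (j | j) <;> simp [Matrix.one_apply]

theorem N1Block_pow_succ (l b : ℝ) (m : ℕ) :
    N1Block l b ^ (m + 1) = N1Block (l ^ (m + 1)) ((m + 1) * l ^ m * b) := by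
  induction m with
  | zero => simp
  | succ m ih =>
    rw [pow_succ, ih]
    simp only [N1Block, Matrix.fromBlocks_multiply]
    congr 1 <;> ext i j <;> simp [Subsingleton.elim i j] <;> ring

theorem matNullity_N1Block_one_sub_one {b : ℝ} (hb : b ≠ 0) :
    matNullity (N1Block 1 b - 1) = 1 := by
  have h : N1Block 1 b - 1 = fromBlocks 0 (b • 1) 0 0 := by
    rw [N1Block, fromBlocks_sub_one, one_smul, sub_self]
  rw [h, matNullity_fromBlocks_zero (by simpa using hb), Fintype.card_fin]

theorem matNullity_N1Block_sub_one {l : ℝ} (b : ℝ) (hl : l ≠ 1) :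
    matNullity (N1Block l b - 1) = 0 := by
  apply matNullity_eq_zero
  rw [N1Block, fromBlocks_sub_one, Matrix.det_fromBlocks_zero₂₁]
  simpa [sub_eq_zero] using hl

theorem matNullity_N1Block_one_pow {b : ℝ} (hb : b ≠ 0) {m : ℕ} (hm : 1 ≤ m) :
    matNullity (N1Block 1 b ^ m - 1) = 1 := by
  obtain ⟨k, rfl⟩ := Nat.exists_eq_add_of_le' hm
  rw [N1Block_pow_succ, one_pow]
  exact matNullity_N1Block_one_sub_one (by rw [one_pow]; positivity)

theorem matNullity_N1Block_neg_one_pow {b : ℝ} (hb : b ≠ 0) {m : ℕ} (hm : 1 ≤ m) :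
    matNullity (N1Block (-1) b ^ m - 1) = if Even m then 1 else 0 := by
  obtain ⟨k, rfl⟩ := Nat.exists_eq_add_of_le' hm
  rw [N1Block_pow_succ]
  split_ifs with h
  · rw [h.neg_one_pow]
    refine matNullity_N1Block_one_sub_one (mul_ne_zero (mul_ne_zero (by positivity) ?_) hb)
    exact pow_ne_zero _ (by norm_num)
  · rw [(Nat.not_even_iff_odd.1 h).neg_one_pow]
    exact matNullity_N1Block_sub_one _ (by norm_num)

theorem matNullity_one_pow (m : ℕ) :
    matNullity ((1 : Matrix (Fin 1 ⊕ Fin 1) (Fin 1 ⊕ Fin 1) ℝ) ^ m - 1) = 2 := by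
  rw [one_pow, sub_self, matNullity_zero]
  rfl

theorem matNullity_neg_one_pow (m : ℕ) :
    matNullity ((-1 : Matrix (Fin 1 ⊕ Fin 1) (Fin 1 ⊕ Fin 1) ℝ) ^ m - 1) =
      if Even m then 2 else 0 := by
  split_ifs with h
  · rw [h.neg_one_pow, sub_self, matNullity_zero]
    rfl
  · rw [(Nat.not_even_iff_odd.1 h).neg_one_pow]
    apply matNullity_eq_zero
    have h2 : (-1 - 1 : Matrix (Fin 1 ⊕ Fin 1) (Fin 1 ⊕ Fin 1) ℝ) = (-2 : ℝ) • 1 := by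
      module
    rw [h2, Matrix.det_smul]
    norm_num

theorem DBlock_pow (l : ℝ) (m : ℕ) : DBlock l ^ m = DBlock (l ^ m) := by
  induction m with
  | zero => simp [DBlock]
  | succ m ih =>
    rw [pow_succ, ih]
    simp only [DBlock, Matrix.fromBlocks_multiply]
    congr 1 <;> simp [smul_smul, pow_succ, mul_comm]

theorem matNullity_DBlock_two_pow {m : ℕ} (hm : 1 ≤ m) :
    matNullity (DBlock 2 ^ m - 1) = 0 := by
  have h : (1 : ℝ) < 2 ^ m := one_lt_pow₀ (by norm_num) (by omega)
  apply matNullity_eq_zero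
  rw [DBlock_pow, DBlock, fromBlocks_sub_one, Matrix.det_fromBlocks_zero₂₁]
  simp [sub_eq_zero, h.ne']

theorem cos_nat_mul_eq_one_iff (m : ℕ) (θ : ℝ) :
    Real.cos (m * θ) = 1 ↔ ∃ z : ℤ, (m : ℝ) * θ / (2 * Real.pi) = z := by
  rw [Real.cos_eq_one_iff]
  have := Real.pi_pos
  refine exists_congr fun z => ?_
  rw [div_eq_iff (by positivity), eq_comm]

theorem sin_eq_zero_of_cos_eq_one {x : ℝ} (h : Real.cos x = 1) : Real.sin x = 0 := by
  have h1 := Real.sin_sq_add_cos_sq x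
  rw [h] at h1
  nlinarith

theorem sin_ne_zero_of_mem {θ : ℝ}
    (h : θ ∈ Set.Ioo 0 Real.pi ∪ Set.Ioo Real.pi (2 * Real.pi)) : Real.sin θ ≠ 0 := by
  rcases h with h | h
  · exact (Real.sin_pos_of_mem_Ioo h).ne'
  · rw [← neg_ne_zero, ← Real.sin_sub_pi]
    exact (Real.sin_pos_of_mem_Ioo ⟨by linarith [h.1], by linarith [h.2]⟩).ne'

theorem rotBlock_pow (θ : ℝ) (m : ℕ) : rotBlock θ ^ m = rotBlock (m * θ) := by
  induction m with
  | zero => simp [rotBlock]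
  | succ m ih =>
    rw [pow_succ, ih, Nat.cast_succ, add_one_mul]
    simp only [rotBlock, Matrix.fromBlocks_multiply, Real.cos_add, Real.sin_add]
    congr 1 <;> ext i j <;> simp [Subsingleton.elim i j] <;> ring

open Classical in
theorem matNullity_rotBlock_pow (θ : ℝ) (m : ℕ) :
    matNullity (rotBlock θ ^ m - 1) =
      if ∃ z : ℤ, (m : ℝ) * θ / (2 * Real.pi) = z then 2 else 0 := by
  rw [rotBlock_pow, ← cos_nat_mul_eq_one_iff]
  split_ifs with h
  · have h0 : rotBlock (m * θ) - 1 = 0 := by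
      rw [rotBlock, h, sin_eq_zero_of_cos_eq_one h, fromBlocks_sub_one]
      simp
    rw [h0, matNullity_zero]
    rfl
  · apply matNullity_eq_zero
    have h1 : (rotBlock (m * θ) - 1).det = 2 * (1 - Real.cos (m * θ)) := by
      rw [← Matrix.det_submatrix_equiv_self (finSumFinEquiv (m := 1) (n := 1)).symm,
        Matrix.det_fin_two]
      have e0 : (finSumFinEquiv (m := 1) (n := 1)).symm 0 = Sum.inl 0 := rfl
      have e1 : (finSumFinEquiv (m := 1) (n := 1)).symm 1 = Sum.inr 0 := rfl
      have := Real.sin_sq_add_cos_sq (m * θ)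
      simp [rotBlock, fromBlocks_sub_one]
      simp [e0, e1]
      linarith
    rw [h1]
    exact mul_ne_zero two_ne_zero (sub_ne_zero.2 (Ne.symm h))

/-- The upper right block of the `(m + 1)`-st power of `N2Block θ B`: `B` is split into the
part commuting with rotations and the part conjugating them to their inverses. -/
def N2PowCorner (θ : ℝ) (B : Matrix (Fin 2) (Fin 2) ℝ) (m : ℕ) : Matrix (Fin 2) (Fin 2) ℝ :=
  ((m + 1 : ℝ) / 2) • (rot2 (m * θ) *
      !![B 0 0 + B 1 1, B 0 1 - B 1 0; B 1 0 - B 0 1, B 0 0 + B 1 1]) +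
    (Real.sin ((m + 1) * θ) / (2 * Real.sin θ)) •
      !![B 0 0 - B 1 1, B 0 1 + B 1 0; B 0 1 + B 1 0, B 1 1 - B 0 0]

theorem rot2_mul_rot2 (x y : ℝ) : rot2 x * rot2 y = rot2 (x + y) := by
  ext i j
  fin_cases i <;> fin_cases j <;>
    simp [rot2, Matrix.mul_apply, Fin.sum_univ_two, Real.cos_add, Real.sin_add] <;> ring

theorem N2Block_pow_succ {θ : ℝ} (hθ : Real.sin θ ≠ 0) (B : Matrix (Fin 2) (Fin 2) ℝ) (m : ℕ) :
    N2Block θ B ^ (m + 1) = fromBlocks (rot2 ((m + 1) * θ)) (N2PowCorner θ B m) 0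
      (rot2 ((m + 1) * θ)) := by
  induction m with
  | zero =>
    have h : N2PowCorner θ B 0 = B := by
      ext i j
      fin_cases i <;> fin_cases j <;>
        simp [N2PowCorner, rot2] <;> field_simp <;> ring
    rw [h]
    simp [N2Block]
  | succ m ih =>
    have h : rot2 ((m + 1) * θ) * B + N2PowCorner θ B m * rot2 θ = N2PowCorner θ B (m + 1) := by
      have e1 : ((m + 1 : ℕ) : ℝ) * θ = m * θ + θ := by push_cast; ring
      have e2 : (((m + 1 : ℕ) : ℝ) + 1) * θ = m * θ + θ + θ := by push_cast; ring
      have e3 : ((m : ℝ) + 1) * θ = m * θ + θ := by ring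
      ext i j
      simp only [N2PowCorner, e1, e2, e3]
      generalize (m : ℝ) * θ = x
      fin_cases i <;> fin_cases j <;>
        simp [rot2, Matrix.vecMul, dotProduct, Fin.sum_univ_two,
          Real.cos_add, Real.sin_add] <;>
        field_simp <;> ring
    rw [pow_succ, ih, N2Block, Matrix.fromBlocks_multiply]
    simp only [Matrix.zero_mul, Matrix.mul_zero, add_zero, zero_add, h, rot2_mul_rot2]
    push_cast
    rw [← add_one_mul]

theorem rot2_eq_one {x : ℝ} (h : Real.cos x = 1) : rot2 x = 1 := by
  rw [rot2, h, sin_eq_zero_of_cos_eq_one h, neg_zero, Matrix.one_fin_two]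

theorem det_rot2_sub_one (x : ℝ) : (rot2 x - 1).det = 2 * (1 - Real.cos x) := by
  have := Real.sin_sq_add_cos_sq x
  simp [rot2, Matrix.det_fin_two]
  linarith

theorem det_rot2 (x : ℝ) : (rot2 x).det = 1 := by
  have := Real.sin_sq_add_cos_sq x
  simp [rot2, Matrix.det_fin_two]
  linarith

open Classical in
theorem matNullity_N2Block_pow {θ : ℝ} (hθ : Real.sin θ ≠ 0) {B : Matrix (Fin 2) (Fin 2) ℝ}
    (hB : B 0 1 ≠ B 1 0) {m : ℕ} (hm : 1 ≤ m) :
    matNullity (N2Block θ B ^ m - 1) =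
      if ∃ z : ℤ, (m : ℝ) * θ / (2 * Real.pi) = z then 2 else 0 := by
  rw [← cos_nat_mul_eq_one_iff]
  obtain ⟨k, rfl⟩ := Nat.exists_eq_add_of_le' hm
  rw [N2Block_pow_succ hθ, fromBlocks_sub_one, Nat.cast_succ]
  split_ifs with h
  · rw [rot2_eq_one h, sub_self, matNullity_fromBlocks_zero, Fintype.card_fin]
    rw [N2PowCorner, sin_eq_zero_of_cos_eq_one h, zero_div, zero_smul, add_zero,
      Matrix.det_smul, Matrix.det_mul, det_rot2, one_mul]
    refine mul_ne_zero (pow_ne_zero _ (by positivity)) ?_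
    rw [Matrix.det_fin_two_of]
    have := sq_pos_of_ne_zero (sub_ne_zero.2 hB)
    nlinarith [sq_nonneg (B 0 0 + B 1 1)]
  · apply matNullity_eq_zero
    rw [Matrix.det_fromBlocks_zero₂₁, det_rot2_sub_one]
    have := mul_ne_zero two_ne_zero (sub_ne_zero.2 (Ne.symm h))
    exact mul_ne_zero this this

end Blocks

open Classical in
theorem sum_ite_two_eq_ncard {k : ℕ} (P : Fin k → Prop) :
    ∑ j, (if P j then 2 else 0) = 2 * {j | P j}.ncard := by
  rw [← Finset.sum_filter, Finset.sum_const, smul_eq_mul, mul_comm, Set.ncard_eq_toFinset_card']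
  congr 2
  ext
  simp

theorem ncard_setOf_one_mul_eq_zero {k : ℕ} {θ : Fin k → ℝ}
    (hθ : ∀ j, θ j ∈ Set.Ioo 0 Real.pi ∪ Set.Ioo Real.pi (2 * Real.pi)) :
    {j : Fin k | ∃ z : ℤ, ((1 : ℕ) : ℝ) * θ j / (2 * Real.pi) = z}.ncard = 0 := by
  rw [Set.ncard_eq_zero, Set.eq_empty_iff_forall_notMem]
  intro j hj
  rw [Set.mem_ofPred_eq, ← cos_nat_mul_eq_one_iff, Nat.cast_one, one_mul] at hj
  exact sin_ne_zero_of_mem (hθ j) (sin_eq_zero_of_cos_eq_one hj)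

theorem matNullity_NFMatrix_pow_sub_one
    (pm p0 pp qm q0 qp rs r0 r hc : ℕ)
    (α : Fin rs → ℝ) (A : Fin rs → Matrix (Fin 2) (Fin 2) ℝ)
    (β : Fin r0 → ℝ) (B : Fin r0 → Matrix (Fin 2) (Fin 2) ℝ)
    (θ : Fin r → ℝ)
    (hα : ∀ j, α j ∈ Set.Ioo 0 Real.pi ∪ Set.Ioo Real.pi (2 * Real.pi))
    (hβ : ∀ j, β j ∈ Set.Ioo 0 Real.pi ∪ Set.Ioo Real.pi (2 * Real.pi))
    (hA : ∀ j, A j 0 1 ≠ A j 1 0) (hB : ∀ j, B j 0 1 ≠ B j 1 0) {m : ℕ} (hm : 1 ≤ m) :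
    matNullity (NFMatrix pm p0 pp qm q0 qp rs r0 r hc α A β B θ ^ m - 1) =
      (pm + 2 * p0 + pp) + (if Even m then 1 else 0) * (qm + 2 * q0 + qp) +
        2 * ({j : Fin r | ∃ z : ℤ, (m : ℝ) * θ j / (2 * Real.pi) = z}.ncard +
          {j : Fin rs | ∃ z : ℤ, (m : ℝ) * α j / (2 * Real.pi) = z}.ncard +
          {j : Fin r0 | ∃ z : ℤ, (m : ℝ) * β j / (2 * Real.pi) = z}.ncard) := by
  classical
  let F := NFBlocks pm p0 pp qm q0 qp rs r0 r hc α A β B θ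
  have hsum : matNullity (NFMatrix pm p0 pp qm q0 qp rs r0 r hc α A β B θ ^ m - 1) =
      ∑ t, matNullity (F t ^ m - 1) := by
    rw [← matNullity_diamondSum_pow_sub_one]
    congr!
  have h1 : ∀ j, matNullity (F (.inl (.inl j)) ^ m - 1) = 1 := fun _ =>
    matNullity_N1Block_one_pow one_ne_zero hm
  have h2 : ∀ j, matNullity (F (.inl (.inr (.inl j))) ^ m - 1) = 2 := fun _ =>
    matNullity_one_pow m
  have h3 : ∀ j, matNullity (F (.inl (.inr (.inr j))) ^ m - 1) = 1 := fun _ =>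
    matNullity_N1Block_one_pow (neg_ne_zero.2 one_ne_zero) hm
  have h4 : ∀ j, matNullity (F (.inr (.inl (.inl j))) ^ m - 1) = if Even m then 1 else 0 :=
    fun _ => matNullity_N1Block_neg_one_pow one_ne_zero hm
  have h5 : ∀ j, matNullity (F (.inr (.inl (.inr (.inl j)))) ^ m - 1) =
      if Even m then 2 else 0 := fun _ => matNullity_neg_one_pow m
  have h6 : ∀ j, matNullity (F (.inr (.inl (.inr (.inr j)))) ^ m - 1) =
      if Even m then 1 else 0 :=
    fun _ => matNullity_N1Block_neg_one_pow (neg_ne_zero.2 one_ne_zero) hm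
  have h7 : ∀ j, matNullity (F (.inr (.inr (.inl (.inl j)))) ^ m - 1) =
      if ∃ z : ℤ, (m : ℝ) * α j / (2 * Real.pi) = z then 2 else 0 :=
    fun j => matNullity_N2Block_pow (sin_ne_zero_of_mem (hα j)) (hA j) hm
  have h8 : ∀ j, matNullity (F (.inr (.inr (.inl (.inr j)))) ^ m - 1) =
      if ∃ z : ℤ, (m : ℝ) * β j / (2 * Real.pi) = z then 2 else 0 :=
    fun j => matNullity_N2Block_pow (sin_ne_zero_of_mem (hβ j)) (hB j) hm
  have h9 : ∀ j, matNullity (F (.inr (.inr (.inr (.inl j)))) ^ m - 1) =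
      if ∃ z : ℤ, (m : ℝ) * θ j / (2 * Real.pi) = z then 2 else 0 :=
    fun j => matNullity_rotBlock_pow (θ j) m
  have h10 : ∀ j, matNullity (F (.inr (.inr (.inr (.inr j)))) ^ m - 1) = 0 :=
    fun _ => matNullity_DBlock_two_pow hm
  rw [hsum]
  simp only [Fintype.sum_sum_type, h1, h2, h3, h4, h5, h6, h7, h8, h9, h10,
    sum_ite_two_eq_ncard, Finset.sum_const, Finset.card_univ, Fintype.card_fin, smul_eq_mul]
  split_ifs <;> ring

/-- Nullity iteration formula for the normal form matrix: for every `m ≥ 1`,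
`dim ker(M^m - I) = (p₋ + 2p₀ + p₊) + ((1+(-1)^m)/2)·(q₋ + 2q₀ + q₊) + 2ς(m)`,
where `ς(m)` counts the indices `j` with `mθ_j/2π ∈ ℤ`, `mα_j/2π ∈ ℤ`,
`mβ_j/2π ∈ ℤ` respectively. In particular `dim ker(M - I) = p₋ + 2p₀ + p₊`. -/
theorem nullity_iteration_formula_normal_form
    (pm p0 pp qm q0 qp rs r0 r hc : ℕ)
    (α : Fin rs → ℝ) (A : Fin rs → Matrix (Fin 2) (Fin 2) ℝ)
    (β : Fin r0 → ℝ) (B : Fin r0 → Matrix (Fin 2) (Fin 2) ℝ)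
    (θ : Fin r → ℝ)
    (hα : ∀ j, α j ∈ Set.Ioo 0 Real.pi ∪ Set.Ioo Real.pi (2 * Real.pi))
    (hβ : ∀ j, β j ∈ Set.Ioo 0 Real.pi ∪ Set.Ioo Real.pi (2 * Real.pi))
    (hθ : ∀ j, θ j ∈ Set.Ioo 0 Real.pi ∪ Set.Ioo Real.pi (2 * Real.pi))
    (hA : ∀ j, A j 0 1 ≠ A j 1 0) (hB : ∀ j, B j 0 1 ≠ B j 1 0) :
    (∀ m : ℕ, 1 ≤ m →
      (Module.finrank ℝ (LinearMap.ker (Matrix.toLin'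
          ((NFMatrix pm p0 pp qm q0 qp rs r0 r hc α A β B θ) ^ m - 1))) : ℤ) =
        ((pm : ℤ) + 2 * p0 + pp) +
          (1 + (-1) ^ m) / 2 * ((qm : ℤ) + 2 * q0 + qp) +
          2 * (({j : Fin r | ∃ z : ℤ, (m : ℝ) * θ j / (2 * Real.pi) = z}.ncard : ℤ) +
               ({j : Fin rs | ∃ z : ℤ, (m : ℝ) * α j / (2 * Real.pi) = z}.ncard : ℤ) +
               ({j : Fin r0 | ∃ z : ℤ, (m : ℝ) * β j / (2 * Real.pi) = z}.ncard : ℤ))) ∧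
    Module.finrank ℝ (LinearMap.ker (Matrix.toLin'
        ((NFMatrix pm p0 pp qm q0 qp rs r0 r hc α A β B θ) - 1))) =
      pm + 2 * p0 + pp := by
  have key : ∀ m : ℕ, 1 ≤ m → _ := fun m hm =>
    matNullity_NFMatrix_pow_sub_one pm p0 pp qm q0 qp rs r0 r hc α A β B θ hα hβ hA hB hm
  constructor
  · intro m hm
    have h := key m hm
    rw [matNullity] at h
    rw [h]
    push_cast
    split_ifs with he
    · rw [he.neg_one_pow]
      norm_num
    · rw [(Nat.not_even_iff_odd.1 he).neg_one_pow]
      norm_num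
  · have h := key 1 le_rfl
    rw [matNullity, pow_one, ncard_setOf_one_mul_eq_zero hα, ncard_setOf_one_mul_eq_zero hβ,
      ncard_setOf_one_mul_eq_zero hθ] at h
    rw [h]
    simp

end
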